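/- Fix q ∈ [1,∞] and let p satisfy 1/p + 1/q = 1. Consider binary classification data (X_i,Y_i) with X_i ∈ ℝ^d and Y_i ∈ {−1,+1}, and the cost c((x,y),(u,v)) = N_q((x,y),(u,v)). Then for the log-exponential (logistic) loss, for every δ > 0: min_{β ∈ ℝ^d} sup { E_P[log(1 + exp(−Y βᵀX))] : D_c(P,P_n) ≤ δ } = min_{β ∈ ℝ^d} { (1/n) Σ_{i=1}^n log(1 + exp(−Y_i βᵀX_i)) + δ ‖β‖_p }. -/

import Mathlib

open MeasureTheory ProbabilityTheory Filter
open scoped ENNReal NNReal Topology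

noncomputable section

/-- The ℓ_p norm on `Fin d → ℝ`, for `p ∈ [1,∞]`. -/
def lpNorm (p : ℝ≥0∞) {d : ℕ} (x : Fin d → ℝ) : ℝ :=
  if p = ⊤ then ⨆ i, |x i| else (∑ i, |x i| ^ p.toReal) ^ (1 / p.toReal)

/-- Optimal transport discrepancy with cost `c`. -/
def OTCost {α : Type*} [MeasurableSpace α] (c : α → α → ℝ≥0∞) (P Q : Measure α) : ℝ≥0∞ :=
  ⨅ (π : Measure (α × α)) (_ : IsProbabilityMeasure π) (_ : π.map Prod.fst = P)
    (_ : π.map Prod.snd = Q), ∫⁻ z, c z.1 z.2 ∂π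

/-- Empirical measure of the points `W 0, …, W (n-1)`. -/
def empMeas {α : Type*} [MeasurableSpace α] {n : ℕ} (W : Fin n → α) : Measure α :=
  (n : ℝ≥0∞)⁻¹ • ∑ i, Measure.dirac (W i)

/-- Extended-real-valued expectation `E_P[l]`, defined via positive and negative parts. -/
def eExp {α : Type*} [MeasurableSpace α] (P : Measure α) (l : α → ℝ) : EReal :=
  ((∫⁻ z, ENNReal.ofReal (l z) ∂P : ℝ≥0∞) : EReal)
    - ((∫⁻ z, ENNReal.ofReal (-(l z)) ∂P : ℝ≥0∞) : EReal)

lemma lpNorm_top_eq {d : ℕ} (x : Fin d → ℝ) : _root_.lpNorm ⊤ x = ⨆ i, |x i| := by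
  simp [_root_.lpNorm]

lemma lpNorm_one_eq {d : ℕ} (x : Fin d → ℝ) : _root_.lpNorm 1 x = ∑ i, |x i| := by
  simp [_root_.lpNorm]

lemma lpNorm_eq_of_ne_top {p : ℝ≥0∞} (hp : p ≠ ⊤) {d : ℕ} (x : Fin d → ℝ) :
    _root_.lpNorm p x = (∑ i, |x i| ^ p.toReal) ^ (1 / p.toReal) := by
  simp [_root_.lpNorm, hp]

lemma lpNorm_nonneg' (p : ℝ≥0∞) {d : ℕ} (x : Fin d → ℝ) : 0 ≤ _root_.lpNorm p x := by
  unfold _root_.lpNorm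
  split_ifs
  · exact Real.iSup_nonneg fun i => abs_nonneg _
  · positivity

lemma lpNorm_smul' {p : ℝ≥0∞} (hp : p ≠ 0) {d : ℕ} (a : ℝ) (x : Fin d → ℝ) :
    _root_.lpNorm p (a • x) = |a| * _root_.lpNorm p x := by
  by_cases h : p = ⊤
  · subst h
    simp only [lpNorm_top_eq, Pi.smul_apply, smul_eq_mul, abs_mul]
    exact (Real.mul_iSup_of_nonneg (abs_nonneg a) _).symm
  · have hp' : p.toReal ≠ 0 := (ENNReal.toReal_pos hp h).ne'
    simp only [lpNorm_eq_of_ne_top h, Pi.smul_apply, smul_eq_mul, abs_mul]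
    simp_rw [Real.mul_rpow (abs_nonneg _) (abs_nonneg _)]
    rw [← Finset.mul_sum, Real.mul_rpow (by positivity) (by positivity),
      ← Real.rpow_mul (abs_nonneg a), mul_one_div_cancel hp', Real.rpow_one]

/-- For conjugate exponents, either one of them is `1` and the other `⊤`, or both are finite. -/
lemma holderConjugate_cases {p q : ℝ≥0∞} (hpq : p⁻¹ + q⁻¹ = 1) :
    (p = ⊤ ∧ q = 1) ∨ (p = 1 ∧ q = ⊤) ∨
      (p ≠ ⊤ ∧ q ≠ ⊤ ∧ p.toReal.HolderConjugate q.toReal) := by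
  have : p.HolderConjugate q := ENNReal.holderConjugate_iff.2 hpq
  by_cases hp : p = ⊤
  · subst hp
    exact Or.inl ⟨rfl, by simpa using hpq⟩
  by_cases hq : q = ⊤
  · subst hq
    exact Or.inr (Or.inl ⟨by simpa using hpq, rfl⟩)
  have hp0 : p ≠ 0 := by rintro rfl; simp at hpq
  have hq0 : q ≠ 0 := by rintro rfl; simp at hpq
  have := ENNReal.HolderTriple.toReal 1 (ENNReal.toReal_pos hp0 hp) (ENNReal.toReal_pos hq0 hq)
  rw [ENNReal.toReal_one] at this
  exact Or.inr (Or.inr ⟨hp, hq, this⟩)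

lemma sum_mul_le_lpNorm_one_mul_lpNorm_top {d : ℕ} (x y : Fin d → ℝ) :
    ∑ j, x j * y j ≤ _root_.lpNorm 1 x * _root_.lpNorm ⊤ y := by
  rw [lpNorm_one_eq, lpNorm_top_eq, Finset.sum_mul]
  refine Finset.sum_le_sum fun j _ => (le_abs_self _).trans ?_
  rw [abs_mul]
  exact mul_le_mul_of_nonneg_left (le_ciSup (f := fun i => |y i|) (Set.finite_range _).bddAbove j)
    (abs_nonneg _)

/-- **Hölder's inequality** for `lpNorm`. -/
lemma sum_mul_le_lpNorm_mul_lpNorm {p q : ℝ≥0∞} (hpq : p⁻¹ + q⁻¹ = 1) {d : ℕ}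
    (x y : Fin d → ℝ) : ∑ j, x j * y j ≤ _root_.lpNorm p x * _root_.lpNorm q y := by
  rcases holderConjugate_cases hpq with ⟨rfl, rfl⟩ | ⟨rfl, rfl⟩ | ⟨hp, hq, h⟩
  · simpa only [mul_comm] using sum_mul_le_lpNorm_one_mul_lpNorm_top y x
  · exact sum_mul_le_lpNorm_one_mul_lpNorm_top x y
  · rw [lpNorm_eq_of_ne_top hp, lpNorm_eq_of_ne_top hq]
    exact Real.inner_le_Lp_mul_Lq _ x y h

lemma abs_sum_mul_le_lpNorm_mul_lpNorm {p q : ℝ≥0∞} (hpq : p⁻¹ + q⁻¹ = 1) {d : ℕ}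
    (x y : Fin d → ℝ) : |∑ j, x j * y j| ≤ _root_.lpNorm p x * _root_.lpNorm q y := by
  have hq : q ≠ 0 := by rintro rfl; simp at hpq
  refine abs_le'.2 ⟨sum_mul_le_lpNorm_mul_lpNorm hpq x y, ?_⟩
  have h := sum_mul_le_lpNorm_mul_lpNorm hpq x ((-1 : ℝ) • y)
  rw [lpNorm_smul' hq] at h
  simpa using h

/-- The bound in Hölder's inequality is attained. -/
lemma exists_lpNorm_le_one_sum_mul_eq {p q : ℝ≥0∞} (hpq : p⁻¹ + q⁻¹ = 1) {d : ℕ}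
    (x : Fin d → ℝ) :
    ∃ u : Fin d → ℝ, _root_.lpNorm q u ≤ 1 ∧ ∑ j, x j * u j = _root_.lpNorm p x := by
  rcases holderConjugate_cases hpq with ⟨rfl, rfl⟩ | ⟨rfl, rfl⟩ | ⟨hp, hq, h⟩
  · rcases isEmpty_or_nonempty (Fin d) with hd | hd
    · exact ⟨0, by simp [lpNorm_one_eq], by simp [lpNorm_top_eq]⟩
    obtain ⟨k, hk⟩ := Finite.exists_max fun i => |x i|
    refine ⟨Pi.single k (SignType.sign (x k) : ℝ), ?_, ?_⟩
    · rw [lpNorm_one_eq, Finset.sum_eq_single k]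
      · rcases lt_trichotomy (x k) 0 with h | h | h <;> simp [h]
      · intro b _ hb
        simp [hb]
      · simp
    · rw [lpNorm_top_eq, Finset.sum_eq_single k]
      · rw [Pi.single_eq_same, self_mul_sign]
        exact le_antisymm (le_ciSup (f := fun i => |x i|) (Set.finite_range _).bddAbove k)
          (ciSup_le hk)
      · intro b _ hb
        simp [hb]
      · simp
  · refine ⟨fun j => (SignType.sign (x j) : ℝ), ?_, ?_⟩
    · rw [lpNorm_top_eq]
      refine Real.iSup_le (fun j => ?_) zero_le_one
      rcases lt_trichotomy (x j) 0 with h | h | h <;> simp [h]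
    · simp only [self_mul_sign, lpNorm_one_eq]
  · obtain ⟨g, hg, hgx⟩ :=
      (NNReal.isGreatest_Lp Finset.univ (fun j => Real.nnabs (x j)) h).1
    refine ⟨fun j => SignType.sign (x j) * g j, ?_, ?_⟩
    · rw [lpNorm_eq_of_ne_top hq]
      refine Real.rpow_le_one (by positivity) ?_ h.symm.one_div_nonneg
      have hg1 : (∑ j, (g j : ℝ) ^ q.toReal) ≤ 1 := by exact_mod_cast hg
      refine le_trans (Finset.sum_le_sum fun j _ => ?_) hg1
      refine Real.rpow_le_rpow (abs_nonneg _) ?_ h.symm.nonneg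
      rw [abs_mul, NNReal.abs_eq]
      refine mul_le_of_le_one_left (g j).2 ?_
      rcases lt_trichotomy (x j) 0 with h | h | h <;> simp [h]
    · rw [lpNorm_eq_of_ne_top hp]
      have := congrArg NNReal.toReal hgx
      push_cast at this
      simp only [← mul_assoc, self_mul_sign]
      simpa using this

/-- The logistic function `a ↦ log (1 + exp a)` is `1`-Lipschitz. -/
lemma log_one_add_exp_le_add_abs_sub (a b : ℝ) :
    Real.log (1 + Real.exp a) ≤ Real.log (1 + Real.exp b) + |a - b| := by
  have h1 : 1 + Real.exp a ≤ (1 + Real.exp b) * Real.exp |a - b| := by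
    have h2 : 1 ≤ Real.exp |a - b| := Real.one_le_exp (abs_nonneg _)
    have h3 : Real.exp a ≤ Real.exp b * Real.exp |a - b| := by
      rw [← Real.exp_add]
      exact Real.exp_le_exp.2 (by linarith [le_abs_self (a - b)])
    linarith
  calc Real.log (1 + Real.exp a) ≤ Real.log ((1 + Real.exp b) * Real.exp |a - b|) :=
        Real.log_le_log (by positivity) h1
    _ = _ := by rw [Real.log_mul (by positivity) (by positivity), Real.log_exp]

lemma le_log_one_add_exp (a : ℝ) : a ≤ Real.log (1 + Real.exp a) :=
  (Real.le_log_iff_exp_le (by positivity)).2 (by linarith)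

lemma log_one_add_exp_nonneg (a : ℝ) : 0 ≤ Real.log (1 + Real.exp a) :=
  Real.log_nonneg (by linarith [Real.exp_pos a])

lemma map_empMeas {α γ : Type*} [MeasurableSpace α] [MeasurableSpace γ] {n : ℕ} (W : Fin n → α)
    {f : α → γ} (hf : Measurable f) : (empMeas W).map f = empMeas (fun i => f (W i)) := by
  simp only [empMeas, Measure.map_smul]
  congr 1
  rw [← Measure.mapₗ_apply_of_measurable hf, map_sum]
  simp [Measure.mapₗ_apply_of_measurable hf, Measure.map_dirac' hf]

lemma lintegral_empMeas {α : Type*} [MeasurableSpace α] [MeasurableSingletonClass α] {n : ℕ}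
    (W : Fin n → α) (f : α → ℝ≥0∞) :
    ∫⁻ z, f z ∂(empMeas W) = (n : ℝ≥0∞)⁻¹ * ∑ i, f (W i) := by
  simp [empMeas]

lemma isProbabilityMeasure_empMeas {α : Type*} [MeasurableSpace α] {n : ℕ} (hn : 0 < n)
    (W : Fin n → α) : IsProbabilityMeasure (empMeas W) := by
  refine ⟨?_⟩
  simp only [empMeas, Measure.smul_apply, Measure.coe_finsetSum, Finset.sum_apply, measure_univ]
  simpa using ENNReal.inv_mul_cancel (by exact_mod_cast hn.ne') (ENNReal.natCast_ne_top n)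

lemma lintegral_ofReal_empMeas {α : Type*} [MeasurableSpace α] [MeasurableSingletonClass α]
    {n : ℕ} (hn : 0 < n) (W : Fin n → α) {f : α → ℝ} (hf : ∀ z, 0 ≤ f z) :
    ∫⁻ z, ENNReal.ofReal (f z) ∂(empMeas W) = ENNReal.ofReal ((n : ℝ)⁻¹ * ∑ i, f (W i)) := by
  rw [lintegral_empMeas, ENNReal.ofReal_mul (by positivity),
    ENNReal.ofReal_sum_of_nonneg fun i _ => hf _, ENNReal.ofReal_inv_of_pos (by positivity),
    ENNReal.ofReal_natCast]

lemma eExp_of_nonneg {α : Type*} [MeasurableSpace α] (P : Measure α) {l : α → ℝ}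
    (hl : ∀ z, 0 ≤ l z) : eExp P l = ((∫⁻ z, ENNReal.ofReal (l z) ∂P : ℝ≥0∞) : EReal) := by
  simp [eExp, ENNReal.ofReal_of_nonpos, hl]

/-- The log-exponential loss `log (1 + exp (-y βᵀx))` of a labelled point `(x, y)`. -/
def logisticLoss {d : ℕ} (β : Fin d → ℝ) (z : (Fin d → ℝ) × ℝ) : ℝ :=
  Real.log (1 + Real.exp (-(z.2 * ∑ j, β j * z.1 j)))

lemma logisticLoss_nonneg {d : ℕ} (β : Fin d → ℝ) (z : (Fin d → ℝ) × ℝ) :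
    0 ≤ logisticLoss β z := log_one_add_exp_nonneg _

@[fun_prop]
lemma measurable_logisticLoss {d : ℕ} (β : Fin d → ℝ) : Measurable (logisticLoss β) := by
  unfold logisticLoss
  fun_prop

/-- For a `±1` label, the loss is Lipschitz in the feature vector. -/
lemma logisticLoss_le_add {p q : ℝ≥0∞} (hpq : p⁻¹ + q⁻¹ = 1) {d : ℕ} (β x u : Fin d → ℝ) {y : ℝ}
    (hy : y = 1 ∨ y = -1) :
    logisticLoss β (x, y) ≤
      logisticLoss β (u, y) + _root_.lpNorm p β * _root_.lpNorm q (x - u) := by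
  refine (log_one_add_exp_le_add_abs_sub _ (-(y * ∑ j, β j * u j))).trans ?_
  refine add_le_add le_rfl ?_
  have h1 : -(y * ∑ j, β j * x j) - -(y * ∑ j, β j * u j) = -y * ∑ j, β j * (x - u) j := by
    simp only [Pi.sub_apply, mul_sub, Finset.sum_sub_distrib]
    ring
  have h2 : |-y| = 1 := by rcases hy with rfl | rfl <;> simp
  rw [h1, abs_mul, h2, one_mul]
  exact abs_sum_mul_le_lpNorm_mul_lpNorm hpq β (x - u)

lemma logisticLoss_eq_log_two {p q : ℝ≥0∞} (hpq : p⁻¹ + q⁻¹ = 1) {d : ℕ} {β : Fin d → ℝ}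
    (hβ : _root_.lpNorm p β = 0) (z : (Fin d → ℝ) × ℝ) : logisticLoss β z = Real.log 2 := by
  have h := abs_sum_mul_le_lpNorm_mul_lpNorm hpq β z.1
  rw [hβ, zero_mul, abs_nonpos_iff] at h
  simp [logisticLoss, h, one_add_one_eq_two]

/-- The transport cost `N_q` on labelled points. -/
def labelCost (q : ℝ≥0∞) {d : ℕ} (z w : (Fin d → ℝ) × ℝ) : ℝ≥0∞ :=
  if z.2 = w.2 then ENNReal.ofReal (_root_.lpNorm q (z.1 - w.1)) else ⊤

lemma ofReal_logisticLoss_le_add_labelCost {p q : ℝ≥0∞} (hpq : p⁻¹ + q⁻¹ = 1) {d : ℕ}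
    (β : Fin d → ℝ) (z w : (Fin d → ℝ) × ℝ) (hw : w.2 = 1 ∨ w.2 = -1) :
    ENNReal.ofReal (logisticLoss β z) ≤ ENNReal.ofReal (logisticLoss β w) +
      ENNReal.ofReal (_root_.lpNorm p β) * labelCost q z w := by
  obtain ⟨x, y⟩ := z
  obtain ⟨u, v⟩ := w
  by_cases hyv : y = v
  · subst hyv
    rw [labelCost, if_pos rfl, ← ENNReal.ofReal_mul (lpNorm_nonneg' p β),
      ← ENNReal.ofReal_add (logisticLoss_nonneg _ _)
        (mul_nonneg (lpNorm_nonneg' p β) (lpNorm_nonneg' q _))]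
    exact ENNReal.ofReal_le_ofReal (logisticLoss_le_add hpq β x u hw)
  · rcases (lpNorm_nonneg' p β).eq_or_lt' with h0 | h0
    · simp [logisticLoss_eq_log_two hpq h0]
    · simp [labelCost, hyv, ENNReal.mul_top, h0]

lemma ae_empMeas {α : Type*} [MeasurableSpace α] [MeasurableSingletonClass α] {n : ℕ}
    {W : Fin n → α} {s : α → Prop} (h : ∀ i, s (W i)) : ∀ᵐ z ∂(empMeas W), s z := by
  rw [ae_iff]
  simp [empMeas, h]

/-- The empirical logistic loss with an `ℓ_p` penalty. -/
def penalizedRisk (p : ℝ≥0∞) {d n : ℕ} (W : Fin n → (Fin d → ℝ) × ℝ) (δ : ℝ) (β : Fin d → ℝ) : ℝ :=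
  (n : ℝ)⁻¹ * ∑ i, logisticLoss β (W i) + δ * _root_.lpNorm p β

lemma penalizedRisk_nonneg (p : ℝ≥0∞) {d n : ℕ} (W : Fin n → (Fin d → ℝ) × ℝ) {δ : ℝ} (hδ : 0 ≤ δ)
    (β : Fin d → ℝ) : 0 ≤ penalizedRisk p W δ β :=
  add_nonneg (mul_nonneg (by positivity) (Finset.sum_nonneg fun i _ => logisticLoss_nonneg _ _))
    (mul_nonneg hδ (lpNorm_nonneg' p β))

lemma eExp_logisticLoss_le_penalizedRisk {p q : ℝ≥0∞} (hpq : p⁻¹ + q⁻¹ = 1) {d n : ℕ} (hn : 0 < n)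
    (W : Fin n → (Fin d → ℝ) × ℝ) (hW : ∀ i, (W i).2 = 1 ∨ (W i).2 = -1) {δ : ℝ} (hδ : 0 ≤ δ)
    (β : Fin d → ℝ) (P : Measure ((Fin d → ℝ) × ℝ))
    (hP : OTCost (labelCost q) P (empMeas W) ≤ ENNReal.ofReal δ) :
    eExp P (logisticLoss β) ≤ (penalizedRisk p W δ β : EReal) := by
  have bound : ∀ δ' ∈ Set.Ioi δ, ∫⁻ z, ENNReal.ofReal (logisticLoss β z) ∂P ≤
      ENNReal.ofReal (penalizedRisk p W δ' β) := by
    intro δ' hδ'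
    have hδ0 : 0 < δ' := hδ.trans_lt hδ'
    have hlt := hP.trans_lt ((ENNReal.ofReal_lt_ofReal_iff hδ0).2 hδ')
    simp only [OTCost, iInf_lt_iff] at hlt
    obtain ⟨π, -, rfl, h2, hcost⟩ := hlt
    have hlabel : ∀ᵐ z ∂π, z.2.2 = 1 ∨ z.2.2 = -1 := by
      refine ae_of_ae_map (p := fun w : (Fin d → ℝ) × ℝ => w.2 = 1 ∨ w.2 = -1)
        measurable_snd.aemeasurable ?_
      rw [h2]
      exact ae_empMeas hW
    have hmeas : Measurable fun z => ENNReal.ofReal (logisticLoss β z) := by fun_prop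
    rw [lintegral_map hmeas measurable_fst]
    calc ∫⁻ z, ENNReal.ofReal (logisticLoss β z.1) ∂π
        ≤ ∫⁻ z, (ENNReal.ofReal (logisticLoss β z.2) +
            ENNReal.ofReal (_root_.lpNorm p β) * labelCost q z.1 z.2) ∂π :=
          lintegral_mono_ae <| hlabel.mono fun z hz =>
            ofReal_logisticLoss_le_add_labelCost hpq β z.1 z.2 hz
      _ = ∫⁻ w, ENNReal.ofReal (logisticLoss β w) ∂(empMeas W) +
            ENNReal.ofReal (_root_.lpNorm p β) * ∫⁻ z, labelCost q z.1 z.2 ∂π := by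
          rw [lintegral_add_left (show Measurable fun z : ((Fin d → ℝ) × ℝ) × ((Fin d → ℝ) × ℝ) =>
            ENNReal.ofReal (logisticLoss β z.2) from hmeas.comp measurable_snd),
            lintegral_const_mul' _ _ ENNReal.ofReal_ne_top, ← h2,
            lintegral_map hmeas measurable_snd]
      _ ≤ ENNReal.ofReal ((n : ℝ)⁻¹ * ∑ i, logisticLoss β (W i)) +
            ENNReal.ofReal (_root_.lpNorm p β) * ENNReal.ofReal δ' := by
          rw [lintegral_ofReal_empMeas hn W (logisticLoss_nonneg β)]
          gcongr
      _ = ENNReal.ofReal (penalizedRisk p W δ' β) := by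
          rw [← ENNReal.ofReal_mul (lpNorm_nonneg' p β), ← ENNReal.ofReal_add
            (mul_nonneg (by positivity) (Finset.sum_nonneg fun i _ => logisticLoss_nonneg _ _))
            (mul_nonneg (lpNorm_nonneg' p β) hδ0.le), mul_comm (_root_.lpNorm p β), penalizedRisk]
  have hcont : Continuous fun δ' => ENNReal.ofReal (penalizedRisk p W δ' β) := by
    refine ENNReal.continuous_ofReal.comp ?_
    unfold penalizedRisk
    fun_prop
  have hle := ge_of_tendsto (hcont.continuousWithinAt (s := Set.Ioi δ) (x := δ))
    (eventually_nhdsWithin_of_forall bound)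
  rw [eExp_of_nonneg P (logisticLoss_nonneg β)]
  refine (EReal.coe_ennreal_le_coe_ennreal_iff.2 hle).trans_eq ?_
  rw [EReal.coe_ennreal_ofReal, max_eq_left (penalizedRisk_nonneg p W hδ β)]

lemma logisticLoss_shift_ge {d : ℕ} (β x u : Fin d → ℝ) {y : ℝ} (hy : y = 1 ∨ y = -1) (t : ℝ) :
    t * ∑ j, β j * u j - y * ∑ j, β j * x j ≤ logisticLoss β (x - (y * t) • u, y) := by
  refine le_trans (le_of_eq ?_) (le_log_one_add_exp _)
  have hy2 : y * y = 1 := by rcases hy with rfl | rfl <;> norm_num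
  have h : ∑ j, β j * (x - (y * t) • u) j = ∑ j, β j * x j - y * t * ∑ j, β j * u j := by
    simp only [Pi.sub_apply, Pi.smul_apply, smul_eq_mul, mul_sub, Finset.sum_sub_distrib,
      Finset.mul_sum]
    congr 1
    exact Finset.sum_congr rfl fun j _ => by ring
  rw [h]
  linear_combination (-t * ∑ j, β j * u j) * hy2

/-- Moving a fraction `ε` of the empirical mass from each `W i` to `W' i` costs at most `ε` times
the average cost. -/
lemma OTCost_mixture_le {α : Type*} [MeasurableSpace α] [MeasurableSingletonClass α]
    {c : α → α → ℝ≥0∞} (hc : ∀ z, c z z = 0) {n : ℕ} (hn : 0 < n) (W W' : Fin n → α) {ε : ℝ}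
    (hε0 : 0 ≤ ε) (hε1 : ε ≤ 1) {C : ℝ≥0∞} (hC : ∀ i, c (W' i) (W i) ≤ C) :
    OTCost c (ENNReal.ofReal (1 - ε) • empMeas W + ENNReal.ofReal ε • empMeas W') (empMeas W) ≤
      ENNReal.ofReal ε * C := by
  have hsum : ENNReal.ofReal (1 - ε) + ENNReal.ofReal ε = 1 := by
    rw [← ENNReal.ofReal_add (by linarith) hε0]
    simp
  set π : Measure (α × α) := ENNReal.ofReal (1 - ε) • empMeas (fun i => (W i, W i)) +
    ENNReal.ofReal ε • empMeas (fun i => (W' i, W i)) with hπ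
  have hprob : IsProbabilityMeasure π := by
    have := isProbabilityMeasure_empMeas hn fun i => (W i, W i)
    have := isProbabilityMeasure_empMeas hn fun i => (W' i, W i)
    exact ⟨by simp [hπ, hsum]⟩
  have hfst : π.map Prod.fst = ENNReal.ofReal (1 - ε) • empMeas W + ENNReal.ofReal ε • empMeas W' := by
    rw [hπ, Measure.map_add _ _ measurable_fst, Measure.map_smul, Measure.map_smul,
      map_empMeas _ measurable_fst, map_empMeas _ measurable_fst]
  have hsnd : π.map Prod.snd = empMeas W := by
    rw [hπ, Measure.map_add _ _ measurable_snd, Measure.map_smul, Measure.map_smul,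
      map_empMeas _ measurable_snd, map_empMeas _ measurable_snd, ← add_smul, hsum, one_smul]
  refine (iInf₂_le_of_le π hprob (iInf₂_le hfst hsnd)).trans ?_
  rw [hπ, lintegral_add_measure, lintegral_smul_measure, lintegral_smul_measure,
    lintegral_empMeas, lintegral_empMeas]
  simp only [hc, Finset.sum_const_zero, mul_zero, zero_add, smul_eq_mul]
  gcongr
  calc (n : ℝ≥0∞)⁻¹ * ∑ i, c (W' i) (W i) ≤ (n : ℝ≥0∞)⁻¹ * ∑ _i : Fin n, C := by
        gcongr with i
        exact hC i
    _ = C := by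
        rw [Finset.sum_const, Finset.card_univ, Fintype.card_fin, nsmul_eq_mul, ← mul_assoc,
          ENNReal.inv_mul_cancel (by exact_mod_cast hn.ne') (ENNReal.natCast_ne_top n), one_mul]

lemma labelCost_self {q : ℝ≥0∞} (hq : q ≠ 0) {d : ℕ} (z : (Fin d → ℝ) × ℝ) :
    labelCost q z z = 0 := by
  have h := lpNorm_smul' hq 0 (0 : Fin d → ℝ)
  rw [zero_smul, abs_zero, zero_mul] at h
  simp [labelCost, h]

lemma penalizedRisk_le_iSup_eExp {p q : ℝ≥0∞} (hpq : p⁻¹ + q⁻¹ = 1) {d n : ℕ} (hn : 0 < n)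
    (W : Fin n → (Fin d → ℝ) × ℝ) (hW : ∀ i, (W i).2 = 1 ∨ (W i).2 = -1) {δ : ℝ} (hδ : 0 ≤ δ)
    (β : Fin d → ℝ) :
    (penalizedRisk p W δ β : EReal) ≤
      ⨆ (P : Measure ((Fin d → ℝ) × ℝ)) (_ : IsProbabilityMeasure P)
        (_ : OTCost (labelCost q) P (empMeas W) ≤ ENNReal.ofReal δ), eExp P (logisticLoss β) := by
  have hq : q ≠ 0 := by rintro rfl; simp at hpq
  obtain ⟨u, hu, hβu⟩ := exists_lpNorm_le_one_sum_mul_eq hpq β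
  set r : ℝ := (n : ℝ)⁻¹ * ∑ i, (logisticLoss β (W i) + (W i).2 * ∑ j, β j * (W i).1 j) with hr
  have bound : ∀ ε ∈ Set.Ioc (0 : ℝ) 1, ((penalizedRisk p W δ β - ε * r : ℝ) : EReal) ≤
      ⨆ (P : Measure ((Fin d → ℝ) × ℝ)) (_ : IsProbabilityMeasure P)
        (_ : OTCost (labelCost q) P (empMeas W) ≤ ENNReal.ofReal δ),
        eExp P (logisticLoss β) := by
    rintro ε ⟨hε0, hε1⟩
    set W' : Fin n → (Fin d → ℝ) × ℝ :=
      fun i => ((W i).1 - ((W i).2 * (δ / ε)) • u, (W i).2) with hW'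
    have hcost (i : Fin n) : labelCost q (W' i) (W i) ≤ ENNReal.ofReal (δ / ε) := by
      have h1 : (W' i).1 - (W i).1 = (-(W i).2 * (δ / ε)) • u := by
        simp [hW']
      have h2 : |(W i).2| = 1 := by rcases hW i with h | h <;> simp [h]
      rw [labelCost, if_pos rfl, h1, lpNorm_smul' hq, abs_mul, abs_neg, h2, one_mul,
        abs_of_nonneg (by positivity)]
      exact ENNReal.ofReal_le_ofReal (mul_le_of_le_one_right (by positivity) hu)
    have hmix := OTCost_mixture_le (labelCost_self hq) hn W W' hε0.le hε1 hcost
    rw [← ENNReal.ofReal_mul hε0.le, mul_div_cancel₀ _ hε0.ne'] at hmix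
    have hprob : IsProbabilityMeasure
        (ENNReal.ofReal (1 - ε) • empMeas W + ENNReal.ofReal ε • empMeas W') := by
      have := isProbabilityMeasure_empMeas hn W
      have := isProbabilityMeasure_empMeas hn W'
      refine ⟨?_⟩
      simp [← ENNReal.ofReal_add (sub_nonneg.2 hε1) hε0.le]
    refine le_iSup_of_le _ <| le_iSup_of_le hprob <| le_iSup_of_le hmix ?_
    have hn0 : (0 : ℝ) ≤ (n : ℝ)⁻¹ := by positivity
    have hs (V : Fin n → (Fin d → ℝ) × ℝ) : 0 ≤ (n : ℝ)⁻¹ * ∑ i, logisticLoss β (V i) :=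
      mul_nonneg hn0 (Finset.sum_nonneg fun i _ => logisticLoss_nonneg _ _)
    rw [eExp_of_nonneg _ (logisticLoss_nonneg β), lintegral_add_measure, lintegral_smul_measure,
      lintegral_smul_measure, lintegral_ofReal_empMeas hn W (logisticLoss_nonneg β),
      lintegral_ofReal_empMeas hn W' (logisticLoss_nonneg β), smul_eq_mul, smul_eq_mul,
      ← ENNReal.ofReal_mul (sub_nonneg.2 hε1), ← ENNReal.ofReal_mul hε0.le,
      ← ENNReal.ofReal_add (mul_nonneg (sub_nonneg.2 hε1) (hs W)) (mul_nonneg hε0.le (hs W')),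
      EReal.coe_ennreal_ofReal]
    refine EReal.coe_le_coe_iff.2 (le_trans ?_ (le_max_left _ _))
    have hshift : δ / ε * _root_.lpNorm p β - (n : ℝ)⁻¹ * ∑ i, (W i).2 * ∑ j, β j * (W i).1 j ≤
        (n : ℝ)⁻¹ * ∑ i, logisticLoss β (W' i) := by
      calc _ = (n : ℝ)⁻¹ * ∑ i, (δ / ε * ∑ j, β j * u j - (W i).2 * ∑ j, β j * (W i).1 j) := by
            rw [Finset.sum_sub_distrib, Finset.sum_const, Finset.card_univ, Fintype.card_fin,
              nsmul_eq_mul, mul_sub, inv_mul_cancel_left₀ (by positivity), hβu]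
        _ ≤ _ := by
            gcongr with i
            exact logisticLoss_shift_ge β (W i).1 u (hW i) (δ / ε)
    have hscaled := mul_le_mul_of_nonneg_left hshift hε0.le
    rw [mul_sub, ← mul_assoc, mul_div_cancel₀ _ hε0.ne'] at hscaled
    rw [penalizedRisk, hr, Finset.sum_add_distrib]
    linarith
  have hcont : Continuous fun ε : ℝ => ((penalizedRisk p W δ β - ε * r : ℝ) : EReal) :=
    continuous_coe_real_ereal.comp (by fun_prop)
  have hlim := hcont.continuousWithinAt (s := Set.Ioi 0) (x := 0)
  have hle := le_of_tendsto hlim (Filter.mem_of_superset (Ioc_mem_nhdsGT one_pos) bound)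
  simpa using hle

lemma iSup_eExp_logisticLoss_eq_penalizedRisk {p q : ℝ≥0∞} (hpq : p⁻¹ + q⁻¹ = 1) {d n : ℕ}
    (hn : 0 < n) (W : Fin n → (Fin d → ℝ) × ℝ) (hW : ∀ i, (W i).2 = 1 ∨ (W i).2 = -1) {δ : ℝ}
    (hδ : 0 ≤ δ) (β : Fin d → ℝ) :
    ⨆ (P : Measure ((Fin d → ℝ) × ℝ)) (_ : IsProbabilityMeasure P)
      (_ : OTCost (labelCost q) P (empMeas W) ≤ ENNReal.ofReal δ), eExp P (logisticLoss β) =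
      (penalizedRisk p W δ β : EReal) :=
  le_antisymm (iSup_le fun P => iSup_le fun _ => iSup_le fun hP =>
    eExp_logisticLoss_le_penalizedRisk hpq hn W hW hδ β P hP)
    (penalizedRisk_le_iSup_eExp hpq hn W hW hδ β)

/-- distributionally robust representation of regularized logistic regression:
with the log-exponential loss `l(x,y;β) = log(1 + exp(-y βᵀx))`, binary labels
`Y_i ∈ {-1,+1}`, and cost `N_q((x,y),(u,v)) = ‖x-u‖_q` if `y = v`, `+∞` otherwise, with
`q ∈ [1,∞]`, `1/p + 1/q = 1`: for every `δ > 0`,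
`min_β sup { E_P[log(1+exp(-YβᵀX))] : D_c(P,P_n) ≤ δ }
  = min_β { (1/n) ∑ᵢ log(1+exp(-Yᵢ βᵀXᵢ)) + δ ‖β‖_p }`. -/
theorem dr_logistic_regression_representation
    (d n : ℕ) (hn : 0 < n)
    (q p : ℝ≥0∞) (hq : 1 ≤ q) (hpq : p⁻¹ + q⁻¹ = 1)
    (X : Fin n → (Fin d → ℝ)) (Y : Fin n → ℝ) (hY : ∀ i, Y i = 1 ∨ Y i = -1)
    (c : ((Fin d → ℝ) × ℝ) → ((Fin d → ℝ) × ℝ) → ℝ≥0∞)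
    (hc : ∀ x y u v, c (x, y) (u, v) =
      if y = v then ENNReal.ofReal (lpNorm q (x - u)) else ⊤)
    (δ : ℝ) (hδ : 0 < δ) :
    (⨅ β : Fin d → ℝ,
        ⨆ (P : Measure ((Fin d → ℝ) × ℝ)) (_ : IsProbabilityMeasure P)
          (_ : OTCost c P (empMeas (fun i => (X i, Y i))) ≤ ENNReal.ofReal δ),
          eExp P (fun z => Real.log (1 + Real.exp (-(z.2 * ∑ j, β j * z.1 j)))))
      = ((⨅ β : Fin d → ℝ,
            ((n : ℝ)⁻¹ * ∑ i, Real.log (1 + Real.exp (-(Y i * ∑ j, β j * X i j)))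
              + δ * lpNorm p β : ℝ) : ℝ) : EReal) := by
  obtain rfl : c = labelCost q := by
    funext z w
    exact hc z.1 z.2 w.1 w.2
  refine (iInf_congr fun β => iSup_eExp_logisticLoss_eq_penalizedRisk hpq hn
    (fun i => (X i, Y i)) hY hδ.le β).trans ?_
  refine (Monotone.map_ciInf_of_continuousAt (f := Real.toEReal)
    continuous_coe_real_ereal.continuousAt EReal.coe_strictMono.monotone ?_).symm
  exact ⟨0, Set.forall_mem_range.2 fun β => penalizedRisk_nonneg p (fun i => (X i, Y i)) hδ.le β⟩
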